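/- arXiv:1005.5473 — 2 statements merged into one kernel-verified Lean document; each statement's English description precedes it below -/
import Mathlib

section
/- Let p be an odd prime, n ≥ 1 an integer, a an integer coprime to p, and let b be an integer with 2b ≡ 1 (mod pⁿ). Then p^{-n/2} · Σ_{g=0}^{pⁿ-1} exp(2πi·a·b·g²/pⁿ) equals: 1 if n is even; (a|p) if n is odd and p ≡ 1 (mod 8); -i·(a|p) if n is odd and p ≡ 3 (mod 8); -(a|p) if n is odd and p ≡ 5 (mod 8); and i·(a|p) if n is odd and p ≡ 7 (mod 8). -/
def gbin (q : ℂ) : ℕ → ℕ → ℂ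
  | _, 0 => 1
  | 0, _ + 1 => 0
  | m + 1, k + 1 => gbin q m k + q ^ (k + 1) * gbin q m (k + 1)

lemma gbin_zero (q : ℂ) (m : ℕ) : gbin q m 0 = 1 := by cases m <;> rfl

lemma gbin_succ (q : ℂ) (m k : ℕ) :
    gbin q (m + 1) (k + 1) = gbin q m k + q ^ (k + 1) * gbin q m (k + 1) := rfl

lemma gbin_gt (q : ℂ) (m : ℕ) : ∀ k, m < k → gbin q m k = 0 := by
  induction m with
  | zero => intro k hk; cases k with
    | zero => omega
    | succ k => rfl
  | succ m ih => intro k hk; cases k with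
    | zero => omega
    | succ k => rw [gbin_succ, ih k (by omega), ih (k + 1) (by omega)]; simp

lemma gbin_absorb (q : ℂ) (m : ℕ) : ∀ j r, j + r = m →
    (1 - q ^ (j + 1)) * gbin q m (j + 1) = (1 - q ^ r) * gbin q m j := by
  induction m with
  | zero => intro j r h
            obtain ⟨rfl, rfl⟩ : j = 0 ∧ r = 0 := by omega
            simp [gbin]
  | succ m ih =>
    intro j r h
    cases r with
    | zero => rw [gbin_gt q (m+1) (j+1) (by omega)]; simp
    | succ r =>
      have h2 : (1 - q ^ (j + 1)) * gbin q m (j + 1) = (1 - q ^ r) * gbin q m j :=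
        ih j r (by omega)
      cases j with
      | zero =>
        rw [gbin_succ, gbin_zero, gbin_zero]
        rw [gbin_zero] at h2
        simp only [zero_add] at *
        linear_combination q * h2
      | succ j =>
        have h1 := ih j (r + 1) (by omega)
        rw [gbin_succ, gbin_succ]
        linear_combination h1 + q ^ (j + 1 + 1) * h2

lemma gbin_B (q : ℂ) (m k : ℕ) :
    (1 - q ^ (k + 1)) * gbin q (m + 1) (k + 1) = (1 - q ^ (m + 1)) * gbin q m k := by
  by_cases h : k ≤ m
  · obtain ⟨r, rfl⟩ := Nat.exists_eq_add_of_le h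
    have h2 := gbin_absorb q (k + r) k r rfl
    rw [gbin_succ]
    linear_combination q ^ (k + 1) * h2
  · rw [gbin_gt q _ _ (by omega), gbin_gt q m k (by omega)]; simp

lemma gbin_three (q : ℂ) (m k : ℕ) :
    gbin q (m + 2) (k + 1) = gbin q (m + 1) k + gbin q (m + 1) (k + 1)
      - (1 - q ^ (m + 1)) * gbin q m k := by
  rw [gbin_succ q (m + 1), ← gbin_B]; ring

def gf (q : ℂ) (m : ℕ) : ℂ := ∑ j ∈ Finset.range (m + 1), (-1) ^ j * gbin q m j

lemma gf_rec (q : ℂ) (m : ℕ) : gf q (m + 2) = (1 - q ^ (m + 1)) * gf q m := by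
  have e1 : gf q (m + 1) = ∑ j ∈ Finset.range (m + 2 + 1), (-1) ^ j * gbin q (m + 1) j := by
    rw [Finset.sum_range_succ, gbin_gt q (m + 1) (m + 2) (by omega)]; simp [gf]
  have e2 : gf q m = ∑ j ∈ Finset.range (m + 2), (-1) ^ j * gbin q m j := by
    rw [Finset.sum_range_succ, gbin_gt q m (m + 1) (by omega)]; simp [gf]
  rw [Finset.sum_range_succ', gbin_zero] at e1
  have e3 : gf q (m + 1) = ∑ j ∈ Finset.range (m + 2), (-1) ^ j * gbin q (m + 1) j := rfl
  have e4 : gf q (m + 2) = ∑ j ∈ Finset.range (m + 2), (-1) ^ (j + 1) * gbin q (m + 2) (j + 1)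
      + (-1) ^ 0 * 1 := by
    unfold gf; rw [Finset.sum_range_succ', gbin_zero]
  have e5 : ∑ j ∈ Finset.range (m + 2), (-1) ^ (j + 1) * gbin q (m + 2) (j + 1)
      = - ∑ j ∈ Finset.range (m + 2), (-1) ^ j * gbin q (m + 1) j
        + ∑ j ∈ Finset.range (m + 2), (-1) ^ (j + 1) * gbin q (m + 1) (j + 1)
        + (1 - q ^ (m + 1)) * ∑ j ∈ Finset.range (m + 2), (-1) ^ j * gbin q m j := by
    rw [Finset.mul_sum, ← Finset.sum_neg_distrib, ← Finset.sum_add_distrib,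
      ← Finset.sum_add_distrib]
    refine Finset.sum_congr rfl fun j _ => ?_
    rw [gbin_three]; ring
  rw [e4, e5, ← e3, ← e2]
  linear_combination -e1

lemma gf_even (q : ℂ) (M : ℕ) : gf q (2 * M) = ∏ i ∈ Finset.range M, (1 - q ^ (2 * i + 1)) := by
  induction M with
  | zero => simp [gf, gbin]
  | succ M ih => rw [show 2 * (M + 1) = 2 * M + 2 by ring, gf_rec, ih, Finset.prod_range_succ]; ring

lemma tri_sum (z q : ℂ) (M : ℕ) (hzq : z * q = 1) (hq : IsPrimitiveRoot q (2 * M + 1)) :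
    ∑ j ∈ Finset.range (2 * M + 1), z ^ (j * (j + 1) / 2) =
      ∏ i ∈ Finset.range M, (1 - q ^ (2 * i + 1)) := by
  rw [← gf_even]
  refine Finset.sum_congr rfl fun j hj => ?_
  have key : ∀ j, j ≤ 2 * M → gbin q (2 * M) j = (-1) ^ j * z ^ (j * (j + 1) / 2) := by
    intro j
    induction j with
    | zero => intro _; simp [gbin_zero]
    | succ j ih =>
      intro hj
      have h1 := gbin_absorb q (2 * M) j (2 * M - j) (by omega)
      rw [ih (by omega)] at h1
      have hne : 1 - q ^ (j + 1) ≠ 0 := by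
        intro h0
        exact hq.pow_ne_one_of_pos_of_lt (by omega) (by omega) (sub_eq_zero.mp h0).symm
      have h2 : q ^ (2 * M - j) = z ^ (j + 1) := by
        have h3 : q ^ (2 * M - j) * q ^ (j + 1) = 1 := by
          rw [← pow_add, show 2 * M - j + (j + 1) = 2 * M + 1 by omega, hq.pow_eq_one]
        have h4 : z ^ (j + 1) * q ^ (j + 1) = 1 := by rw [← mul_pow, hzq, one_pow]
        calc q ^ (2 * M - j) = q ^ (2 * M - j) * (z ^ (j + 1) * q ^ (j + 1)) := by rw [h4, mul_one]
          _ = z ^ (j + 1) * (q ^ (2 * M - j) * q ^ (j + 1)) := by ring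
          _ = _ := by rw [h3, mul_one]
      have h4 : z ^ (j + 1) * q ^ (j + 1) = 1 := by rw [← mul_pow, hzq, one_pow]
      have h5 : (j + 1) * (j + 1 + 1) / 2 = j * (j + 1) / 2 + (j + 1) := by
        rw [show (j + 1) * (j + 1 + 1) = j * (j + 1) + (j + 1) * 2 by ring,
          Nat.add_mul_div_right _ _ (by norm_num)]
      apply mul_left_cancel₀ hne
      rw [h1, h5, h2, pow_add z, pow_succ (-1 : ℂ)]
      linear_combination (-(-1) ^ j * z ^ (j * (j + 1) / 2)) * h4
  rw [key j (by simp at hj; omega), ← mul_assoc, ← mul_pow]; simp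

noncomputable def ee (N : ℕ) (x : ℤ) : ℂ :=
  Complex.exp (2 * Real.pi * Complex.I * ((x : ℂ) / (N : ℂ)))

lemma ee_std (N : ℕ) [NeZero N] (x : ℤ) : ee N x = ZMod.stdAddChar (x : ZMod N) := by
  rw [ZMod.stdAddChar_coe, ee]; congr 1; ring

lemma ee_add (N : ℕ) (x y : ℤ) : ee N (x + y) = ee N x * ee N y := by
  rw [ee, ee, ee, ← Complex.exp_add]; congr 1; push_cast; ring

lemma ee_mul (K N : ℕ) (hK : K ≠ 0) (y : ℤ) : ee (K * N) (K * y) = ee N y := by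
  have : (K : ℂ) ≠ 0 := by exact_mod_cast hK
  rw [ee, ee]; congr 2; push_cast
  rw [mul_div_mul_left _ _ this]

lemma ee_self (N : ℕ) (hN : N ≠ 0) (y : ℤ) : ee N (N * y) = 1 := by
  have : NeZero N := ⟨hN⟩
  rw [ee_std]; simp

lemma sum_range_zmod (N : ℕ) [NeZero N] (F : ZMod N → ℂ) :
    ∑ g ∈ Finset.range N, F (g : ZMod N) = ∑ x : ZMod N, F x := by
  refine Finset.sum_nbij' (fun g => (g : ZMod N)) (fun x => x.val) ?_ ?_ ?_ ?_ ?_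
  · simp
  · intro x _; simpa using ZMod.val_lt x
  · intro g hg; exact ZMod.val_cast_of_lt (by simpa using hg)
  · intro x _; simp
  · simp

lemma sum_range_mul' (A B : ℕ) (f : ℕ → ℂ) :
    ∑ g ∈ Finset.range (A * B), f g =
      ∑ u ∈ Finset.range A, ∑ v ∈ Finset.range B, f (u + A * v) := by
  rw [Finset.sum_comm]
  induction B with
  | zero => simp
  | succ B ih =>
    rw [Nat.mul_succ, Finset.sum_range_add, ih, Finset.sum_range_succ]
    simp [add_comm]

noncomputable def GG (N : ℕ) (c : ℤ) : ℂ := ∑ g ∈ Finset.range N, ee N (c * (g : ℤ) ^ 2)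

lemma GG_red (p : ℕ) [Fact p.Prime] (hp : Odd p) (n : ℕ) (c : ℤ) (hc : IsCoprime c (p : ℤ)) :
    GG (p ^ (n + 2)) c = p * GG (p ^ n) c := by
  have hp0 : p ≠ 0 := (Fact.out : p.Prime).ne_zero
  have hpp : Prime (p : ℤ) := Nat.prime_iff_prime_int.mp Fact.out
  have hc0 : ((c : ℤ) : ZMod p) ≠ 0 := by
    intro h
    rw [ZMod.intCast_zmod_eq_zero_iff_dvd] at h
    exact hpp.not_isUnit (hc.symm.isUnit_of_dvd h)
  have h20 : (2 : ZMod p) ≠ 0 := by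
    intro h
    have : ((2 : ℕ) : ZMod p) = 0 := by exact_mod_cast h
    rw [ZMod.natCast_eq_zero_iff] at this
    have h3 := (Nat.prime_dvd_prime_iff_eq Fact.out Nat.prime_two).mp this
    subst h3
    exact absurd hp (by decide)
  have inner : ∀ u : ℕ, ∑ v ∈ Finset.range p, ee (p ^ (n + 2)) (c * ((u + p ^ (n + 1) * v : ℕ) : ℤ) ^ 2)
      = ee (p ^ (n + 2)) (c * (u : ℤ) ^ 2) * (if p ∣ u then (p : ℂ) else 0) := by
    intro u
    have h1 : ∀ v : ℕ, ee (p ^ (n + 2)) (c * ((u + p ^ (n + 1) * v : ℕ) : ℤ) ^ 2)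
        = ee (p ^ (n + 2)) (c * (u : ℤ) ^ 2) *
          ZMod.stdAddChar ((v : ZMod p) * (2 * c * u : ZMod p)) := by
      intro v
      have e1 : c * ((u + p ^ (n + 1) * v : ℕ) : ℤ) ^ 2 =
        c * (u : ℤ) ^ 2 + (((p ^ (n + 1) : ℕ) : ℤ) * (v * (2 * c * u)) +
          ((p ^ (n + 2) : ℕ) : ℤ) * (c * p ^ n * v ^ 2)) := by push_cast; ring
      rw [e1, ee_add, ee_add, ee_self _ (pow_ne_zero _ hp0), mul_one]
      have e2 := ee_mul (p ^ (n + 1)) p (pow_ne_zero _ hp0) (v * (2 * c * u))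
      rw [← pow_succ] at e2
      rw [e2, ee_std p]; push_cast; rfl
    simp_rw [h1]
    rw [← Finset.mul_sum]
    congr 1
    rw [sum_range_zmod p (fun v => ZMod.stdAddChar (v * (2 * c * u : ZMod p))),
      AddChar.sum_mulShift _ (ZMod.isPrimitive_stdAddChar p)]
    simp [hc0, h20, ZMod.natCast_eq_zero_iff]
  have e0 : p ^ (n + 2) = p ^ (n + 1) * p := pow_succ _ _
  have : GG (p ^ (n + 2)) c = ∑ u ∈ Finset.range (p * p ^ n),
      ee (p ^ (n + 2)) (c * (u : ℤ) ^ 2) * (if p ∣ u then (p : ℂ) else 0) := by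
    rw [← pow_succ']
    simp_rw [← inner]
    rw [← sum_range_mul' (p ^ (n + 1)) p (fun g => ee (p ^ (n + 2)) (c * (g : ℤ) ^ 2)), ← e0]; rfl
  rw [this, sum_range_mul']
  rw [Finset.sum_eq_single_of_mem 0 (by simp; omega)]
  · rw [GG, Finset.mul_sum]
    refine Finset.sum_congr rfl fun w _ => ?_
    have e2 := ee_mul (p ^ 2) (p ^ n) (pow_ne_zero _ hp0) (c * (w : ℤ) ^ 2)
    rw [← pow_add, add_comm 2 n] at e2
    rw [← e2]
    simp only [zero_add, dvd_mul_right, if_true]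
    rw [mul_comm]; congr 2; push_cast; ring
  · intro r hr hr0
    refine Finset.sum_eq_zero fun w _ => ?_
    rw [if_neg, mul_zero]
    intro h
    rw [Nat.dvd_add_left (dvd_mul_right _ _)] at h
    exact hr0 (Nat.eq_zero_of_dvd_of_lt h (by simpa using hr))

lemma GG_congr (N : ℕ) [NeZero N] (c d : ℤ) (h : (c : ZMod N) = d) : GG N c = GG N d := by
  unfold GG; refine Finset.sum_congr rfl fun g _ => ?_
  rw [ee_std, ee_std]; push_cast; rw [h]

lemma GG_even (p : ℕ) [Fact p.Prime] (hp : Odd p) (c : ℤ) (hc : IsCoprime c (p : ℤ)) (k : ℕ) :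
    GG (p ^ (2 * k)) c = p ^ k := by
  induction k with
  | zero => simp [GG, ee]
  | succ k ih => rw [show 2 * (k + 1) = 2 * k + 2 by ring, GG_red p hp _ c hc, ih]; ring

lemma GG_odd (p : ℕ) [Fact p.Prime] (hp : Odd p) (c : ℤ) (hc : IsCoprime c (p : ℤ)) (k : ℕ) :
    GG (p ^ (2 * k + 1)) c = p ^ k * GG p c := by
  induction k with
  | zero => simp
  | succ k ih => rw [show 2 * (k + 1) + 1 = (2 * k + 1) + 2 by ring, GG_red p hp _ c hc, ih]; ring

/-- relation with the Gauss sum -/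
lemma GG_gauss (p : ℕ) [Fact p.Prime] (hp : Odd p) (c : ℤ) (hc : IsCoprime c (p : ℤ)) :
    GG p c = (legendreSym p c : ℂ) *
      gaussSum ((quadraticChar (ZMod p)).ringHomComp (Int.castRingHom ℂ)) ZMod.stdAddChar := by
  have hpp : Prime (p : ℤ) := Nat.prime_iff_prime_int.mp Fact.out
  have hc0 : ((c : ℤ) : ZMod p) ≠ 0 := by
    intro h
    rw [ZMod.intCast_zmod_eq_zero_iff_dvd] at h
    exact hpp.not_isUnit (hc.symm.isUnit_of_dvd h)
  have hF : ringChar (ZMod p) ≠ 2 := by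
    rw [ZMod.ringChar_zmod_n]; rintro rfl; exact absurd hp (by decide)
  set χ := (quadraticChar (ZMod p)).ringHomComp (Int.castRingHom ℂ) with hχ
  have e1 : GG p c = ∑ x : ZMod p, ZMod.stdAddChar ((c : ZMod p) * x ^ 2) := by
    rw [← sum_range_zmod p (fun x => ZMod.stdAddChar ((c : ZMod p) * x ^ 2))]
    refine Finset.sum_congr rfl fun g _ => ?_
    rw [ee_std]; push_cast; rfl
  have e2 : ∑ x : ZMod p, ZMod.stdAddChar ((c : ZMod p) * x ^ 2) =
      ∑ y : ZMod p, (χ y + 1) * ZMod.stdAddChar ((c : ZMod p) * y) := by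
    rw [← Finset.sum_fiberwise (s := Finset.univ) (g := fun x : ZMod p => x ^ 2)]
    refine Finset.sum_congr rfl fun y _ => ?_
    have h1 := quadraticChar_card_sqrts hF y
    have h2 : ((Finset.univ.filter (fun x : ZMod p => x ^ 2 = y)).card : ℂ) = χ y + 1 := by
      have : (Finset.univ.filter (fun x : ZMod p => x ^ 2 = y)) = {x : ZMod p | x ^ 2 = y}.toFinset := by
        ext; simp
      rw [this]
      have h3 : (((({x : ZMod p | x ^ 2 = y}.toFinset).card : ℤ)) : ℂ) = ((quadraticChar (ZMod p) y + 1 : ℤ) : ℂ) := by rw [h1]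
      push_cast at h3
      rw [h3]; rfl
    rw [← h2, ← nsmul_eq_mul, ← Finset.sum_const]
    refine Finset.sum_congr rfl fun x hx => ?_
    rw [(Finset.mem_filter.mp hx).2]
  have e3 : ∑ y : ZMod p, ZMod.stdAddChar ((c : ZMod p) * y) = 0 := by
    have := AddChar.sum_mulShift (c : ZMod p) (ZMod.isPrimitive_stdAddChar p)
    rw [if_neg hc0] at this
    simpa [mul_comm] using this
  rw [e1, e2]
  simp_rw [add_mul, one_mul]
  rw [Finset.sum_add_distrib, e3, add_zero]
  have h4 := gaussSum_mulShift χ (ZMod.stdAddChar (N := p)) (Units.mk0 _ hc0)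
  have h5 : gaussSum χ (AddChar.mulShift ZMod.stdAddChar ((Units.mk0 _ hc0 : (ZMod p)ˣ) : ZMod p))
    = ∑ y : ZMod p, χ y * ZMod.stdAddChar ((c : ZMod p) * y) := rfl
  rw [← h5, ← h4, ← mul_assoc]
  have h6 : χ ((Units.mk0 _ hc0 : (ZMod p)ˣ) : ZMod p) = (legendreSym p c : ℂ) := rfl
  rw [h6]
  have h7 := legendreSym.sq_one p hc0
  have h8 : (legendreSym p c : ℂ) * (legendreSym p c : ℂ) = 1 := by
    rw [← sq]; exact_mod_cast h7
  rw [h8, one_mul]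

lemma gauss_norm (p : ℕ) [Fact p.Prime] (hp : Odd p) :
    ‖gaussSum ((quadraticChar (ZMod p)).ringHomComp (Int.castRingHom ℂ))
      (ZMod.stdAddChar (N := p))‖ = Real.sqrt p := by
  have hF : ringChar (ZMod p) ≠ 2 := by
    rw [ZMod.ringChar_zmod_n]; rintro rfl; exact absurd hp (by decide)
  have h1 := gaussSum_sq (χ := (quadraticChar (ZMod p)).ringHomComp (Int.castRingHom ℂ))
    (ψ := ZMod.stdAddChar (N := p))
    ((MulChar.ringHomComp_ne_one_iff (RingHom.injective_int _)).mpr (quadraticChar_ne_one hF))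
    ((quadraticChar_isQuadratic _).comp _) (ZMod.isPrimitive_stdAddChar p)
  have h2 := congrArg norm h1
  rw [norm_pow, norm_mul] at h2
  have h3 : ‖((quadraticChar (ZMod p)).ringHomComp (Int.castRingHom ℂ)) (-1)‖ = 1 := by
    rw [MulChar.ringHomComp_apply]
    rcases quadraticChar_dichotomy (F := ZMod p) (a := -1) (by simp) with h | h <;> rw [h] <;> simp
  rw [h3, one_mul, ZMod.card] at h2
  rw [← Real.sqrt_sq (norm_nonneg _), h2]; simp

lemma GG_half (M : ℕ) :
    GG (2 * M + 1) (M + 1) = ee (2 * M + 1) ((M + 1) ^ 3) *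
      ∑ j ∈ Finset.range (2 * M + 1), (ee (2 * M + 1) 1) ^ (j * (j + 1) / 2) := by
  set N := 2 * M + 1 with hN
  have : NeZero N := ⟨by omega⟩
  set b : ZMod N := (M : ZMod N) + 1 with hb
  have h2b : 2 * b = 1 := by
    have : ((2 * M + 1 : ℕ) : ZMod N) = 0 := by rw [← hN]; simp
    push_cast at this
    rw [hb]; linear_combination this
  have e1 : GG N (M + 1) = ∑ x : ZMod N, ZMod.stdAddChar (b * x ^ 2) := by
    rw [← sum_range_zmod N (fun x => ZMod.stdAddChar (b * x ^ 2))]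
    refine Finset.sum_congr rfl fun g _ => ?_
    rw [ee_std]; push_cast; rfl
  have e2 : ∑ x : ZMod N, (ZMod.stdAddChar (b * x ^ 2) : ℂ) =
      ∑ x : ZMod N, ZMod.stdAddChar (b ^ 3) * ZMod.stdAddChar (b * (x * (x + 1))) := by
    rw [← Equiv.sum_comp (Equiv.addRight b)]
    refine Finset.sum_congr rfl fun x _ => ?_
    rw [← AddChar.map_add_eq_mul]; congr 1
    simp only [Equiv.coe_addRight]
    linear_combination (b * x) * h2b
  rw [e1, e2, ← Finset.mul_sum,
    ← sum_range_zmod N (fun x => ZMod.stdAddChar (b * (x * (x + 1))))]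
  congr 1
  · rw [ee_std]; push_cast; rfl
  · refine Finset.sum_congr rfl fun j _ => ?_
    obtain ⟨t, ht⟩ := (Nat.even_mul_succ_self j).two_dvd
    rw [ht, Nat.mul_div_cancel_left _ (by norm_num), ee_std, ← AddChar.map_nsmul_eq_pow]
    congr 1
    have : (j : ZMod N) * (j + 1) = 2 * t := by exact_mod_cast congrArg (Nat.cast : ℕ → ZMod N) ht
    rw [this]; simp; linear_combination (t : ZMod N) * h2b

lemma one_sub_exp (x : ℝ) : 1 - Complex.exp (-(2 * x * Complex.I)) =
    ((2 * Real.sin x : ℝ) : ℂ) * (Complex.I * Complex.exp (-(x * Complex.I))) := by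
  push_cast
  rw [Complex.sin]
  have h1 : Complex.exp (x * Complex.I) * Complex.exp (-(x * Complex.I)) = 1 := by
    rw [← Complex.exp_add]; simp
  have h2 : Complex.exp (-(x * Complex.I)) * Complex.exp (-(x * Complex.I)) =
    Complex.exp (-(2 * x * Complex.I)) := by
    rw [← Complex.exp_add]; congr 1; ring
  have h3 := Complex.I_sq
  rw [show (-(x : ℂ) * Complex.I) = -(x * Complex.I) by ring]
  linear_combination (-Complex.I^2) * h2 + Complex.I ^ 2 * h1
    + (1 - Complex.exp (-(2 * x * Complex.I))) * h3

lemma prod_phase (N : ℕ) (K : ℕ) :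
    ∏ i ∈ Finset.range K,
      (Complex.I * Complex.exp (-(((Real.pi * (2 * i + 1) / N : ℝ) : ℂ) * Complex.I))) =
    Complex.I ^ K * Complex.exp (-(Real.pi * K ^ 2 / N * Complex.I)) := by
  induction K with
  | zero => simp
  | succ K ih =>
    rw [Finset.prod_range_succ, ih, pow_succ, mul_mul_mul_comm, ← Complex.exp_add]
    congr 2; push_cast; ring

lemma GG_phase (M : ℕ) : ∃ r : ℝ, 0 < r ∧
    GG (2 * M + 1) (M + 1) = r * (-Complex.I) ^ M := by
  refine ⟨∏ i ∈ Finset.range M, (2 * Real.sin (Real.pi * (2 * i + 1) / (2 * M + 1 : ℕ))), ?_, ?_⟩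
  · refine Finset.prod_pos fun i hi => ?_
    have hi : (i : ℝ) + 1 ≤ M := by exact_mod_cast Finset.mem_range.mp hi
    have hpi := Real.pi_pos
    refine mul_pos two_pos (Real.sin_pos_of_pos_of_lt_pi (by positivity) ?_)
    rw [div_lt_iff₀ (by positivity)]
    push_cast
    exact mul_lt_mul_of_pos_left (by linarith) hpi
  · have hzq : ee (2 * M + 1) 1 * ee (2 * M + 1) (-1) = 1 := by
      rw [← ee_add]; simp [ee]
    have hz : IsPrimitiveRoot (ee (2 * M + 1) 1) (2 * M + 1) := by
      have := Complex.isPrimitiveRoot_exp (2 * M + 1) (by omega)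
      convert this using 1
      rw [ee]; congr 1; push_cast; ring
    have hq : IsPrimitiveRoot (ee (2 * M + 1) (-1)) (2 * M + 1) := by
      rw [← inv_eq_of_mul_eq_one_right hzq]; exact hz.inv
    rw [GG_half, tri_sum _ _ M hzq hq]
    have h1 : ∀ i : ℕ, 1 - ee (2 * M + 1) (-1) ^ (2 * i + 1) =
        ((2 * Real.sin (Real.pi * (2 * i + 1) / (2 * M + 1 : ℕ)) : ℝ) : ℂ) *
        (Complex.I * Complex.exp (-(((Real.pi * (2 * i + 1) / (2 * M + 1 : ℕ) : ℝ) : ℂ) * Complex.I))) := by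
      intro i
      rw [← one_sub_exp, ee, ← Complex.exp_nat_mul]
      congr 2; push_cast; ring
    simp_rw [h1]
    rw [Finset.prod_mul_distrib, prod_phase, mul_left_comm, ← Complex.ofReal_prod]
    congr 1
    rw [mul_left_comm, ee, ← Complex.exp_add]
    have h2 : 2 * (Real.pi : ℂ) * Complex.I * ((((M : ℤ) + 1) ^ 3 : ℤ) / ((2 * M + 1 : ℕ) : ℂ)) +
        -(Real.pi * (M : ℂ) ^ 2 / ((2 * M + 1 : ℕ) : ℂ) * Complex.I) =
        ((M ^ 2 + 2 * M + 2 : ℕ) : ℂ) * (Real.pi * Complex.I) := by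
      have : ((2 * M + 1 : ℕ) : ℂ) ≠ 0 := Nat.cast_ne_zero.mpr (by omega)
      push_cast at this ⊢
      field_simp
      ring
    rw [h2, Complex.exp_nat_mul, Complex.exp_pi_mul_I, neg_pow Complex.I, mul_comm]
    congr 1
    rw [show M ^ 2 + 2 * M + 2 = M * (M + 1) + (M + 2) by ring, pow_add,
      (Nat.even_mul_succ_self M).neg_one_pow, pow_add]
    simp

lemma GG_value (p : ℕ) [Fact p.Prime] (M : ℕ) (hM : p = 2 * M + 1) (a b : ℤ)
    (ha : IsCoprime a (p : ℤ)) (hb : (p : ℤ) ∣ 2 * b - 1) :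
    GG p (a * b) = (Real.sqrt p : ℂ) * (legendreSym p a : ℂ) * (-Complex.I) ^ M := by
  have hp : Odd p := ⟨M, hM⟩
  have hbc : IsCoprime b (p : ℤ) := by
    obtain ⟨k, hk⟩ := hb
    exact ⟨2, -k, by linear_combination hk⟩
  have hb' : GG p b = GG p (M + 1) := by
    apply GG_congr
    have h1 : (2 * (b : ZMod p)) = 1 := by
      have := (ZMod.intCast_zmod_eq_zero_iff_dvd (2 * b - 1) p).mpr hb
      push_cast at this
      linear_combination this
    have h2 : ((2 * M + 1 : ℕ) : ZMod p) = 0 := by rw [← hM]; simp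
    push_cast at h2 ⊢
    linear_combination ((M : ZMod p) + 1) * h1 - (b : ZMod p) * h2
  have h1 := GG_gauss p hp _ (ha.mul_left hbc)
  have h2 := GG_gauss p hp b hbc
  have h3 : GG p (a * b) = (legendreSym p a : ℂ) * GG p b := by
    rw [h1, h2, legendreSym.mul]; push_cast; ring
  obtain ⟨r, hr, h4⟩ := GG_phase M
  rw [← hM, ← hb'] at h4
  have hb0 : ((b : ℤ) : ZMod p) ≠ 0 := by
    intro h
    rw [ZMod.intCast_zmod_eq_zero_iff_dvd] at h
    exact (Nat.prime_iff_prime_int.mp (Fact.out : p.Prime)).not_isUnit (hbc.symm.isUnit_of_dvd h)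
  have h5 : ‖GG p b‖ = Real.sqrt p := by
    rw [h2, norm_mul, gauss_norm p hp]
    rcases legendreSym.eq_one_or_neg_one p hb0 with h | h <;> rw [h] <;> simp
  have h6 : r = Real.sqrt p := by
    rw [← h5, h4]; simp [abs_of_pos hr]
  rw [h3, h4, h6]; ring

lemma sqrt_pow_two_mul (p k : ℕ) : Real.sqrt ((p : ℝ) ^ (2 * k)) = (p : ℝ) ^ k := by
  rw [mul_comm, pow_mul, Real.sqrt_sq (by positivity)]

lemma sqrt_pow_odd (p k : ℕ) : Real.sqrt ((p : ℝ) ^ (2 * k + 1)) = (p : ℝ) ^ k * Real.sqrt p := by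
  rw [pow_succ, Real.sqrt_mul (by positivity), sqrt_pow_two_mul]

lemma sum_eq_GG (p n : ℕ) (a b : ℤ) : ∑ g ∈ Finset.range (p ^ n),
          Complex.exp (2 * Real.pi * Complex.I *
            ((a : ℂ) * (b : ℂ) * (g : ℂ) ^ 2 / (p : ℂ) ^ n)) = GG (p ^ n) (a * b) := by
  unfold GG ee
  refine Finset.sum_congr rfl fun g _ => ?_
  push_cast; rfl

lemma main_odd (p : ℕ) [Fact p.Prime] (M : ℕ) (hM : p = 2 * M + 1) (n : ℕ) (hn : Odd n)
    (a b : ℤ) (ha : IsCoprime a (p : ℤ)) (hb : (p : ℤ) ∣ 2 * b - 1) :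
    GG (p ^ n) (a * b) =
      (Real.sqrt ((p : ℝ) ^ n) : ℂ) * (legendreSym p a : ℂ) * (-Complex.I) ^ M := by
  obtain ⟨k, rfl⟩ := hn
  have hbc : IsCoprime b (p : ℤ) := by
    obtain ⟨k, hk⟩ := hb
    exact ⟨2, -k, by linear_combination hk⟩
  rw [GG_odd p ⟨M, hM⟩ _ (ha.mul_left hbc), GG_value p M hM a b ha hb, sqrt_pow_odd]
  push_cast; ring

lemma negI_four (t : ℕ) : (-Complex.I) ^ (4 * t) = 1 := by
  rw [pow_mul, show (4 : ℕ) = 2 * 2 from rfl, pow_mul, neg_sq, Complex.I_sq]; norm_num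

/-- For an odd prime `p`, `n ≥ 1`, an integer `a` coprime to `p`, and an
integer `b` with `2b ≡ 1 (mod pⁿ)`, the normalized Gauss sum
`p^{-n/2} ∑_{g=0}^{pⁿ-1} exp(2πi·a·b·g²/pⁿ)` equals `1` if `n` is even, and for odd `n` it
equals `(a|p)`, `-i(a|p)`, `-(a|p)`, `i(a|p)` according as `p ≡ 1, 3, 5, 7 (mod 8)`. -/
theorem stmt_5 (p : ℕ) [Fact p.Prime] (hp : Odd p) (n : ℕ) (hn : 1 ≤ n)
    (a : ℤ) (ha : IsCoprime a (p : ℤ)) (b : ℤ) (hb : ((p : ℤ) ^ n) ∣ (2 * b - 1)) :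
    (Even n →
      ∑ g ∈ Finset.range (p ^ n),
          Complex.exp (2 * Real.pi * Complex.I *
            ((a : ℂ) * (b : ℂ) * (g : ℂ) ^ 2 / (p : ℂ) ^ n)) =
        (Real.sqrt ((p : ℝ) ^ n) : ℂ)) ∧
    (Odd n → p % 8 = 1 →
      ∑ g ∈ Finset.range (p ^ n),
          Complex.exp (2 * Real.pi * Complex.I *
            ((a : ℂ) * (b : ℂ) * (g : ℂ) ^ 2 / (p : ℂ) ^ n)) =
        (Real.sqrt ((p : ℝ) ^ n) : ℂ) * (legendreSym p a : ℂ)) ∧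
    (Odd n → p % 8 = 3 →
      ∑ g ∈ Finset.range (p ^ n),
          Complex.exp (2 * Real.pi * Complex.I *
            ((a : ℂ) * (b : ℂ) * (g : ℂ) ^ 2 / (p : ℂ) ^ n)) =
        -Complex.I * ((Real.sqrt ((p : ℝ) ^ n) : ℂ) * (legendreSym p a : ℂ))) ∧
    (Odd n → p % 8 = 5 →
      ∑ g ∈ Finset.range (p ^ n),
          Complex.exp (2 * Real.pi * Complex.I *
            ((a : ℂ) * (b : ℂ) * (g : ℂ) ^ 2 / (p : ℂ) ^ n)) =
        -((Real.sqrt ((p : ℝ) ^ n) : ℂ) * (legendreSym p a : ℂ))) ∧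
    (Odd n → p % 8 = 7 →
      ∑ g ∈ Finset.range (p ^ n),
          Complex.exp (2 * Real.pi * Complex.I *
            ((a : ℂ) * (b : ℂ) * (g : ℂ) ^ 2 / (p : ℂ) ^ n)) =
        Complex.I * ((Real.sqrt ((p : ℝ) ^ n) : ℂ) * (legendreSym p a : ℂ))) := by
  have hb1 : (p : ℤ) ∣ 2 * b - 1 := (dvd_pow_self (p : ℤ) (by omega)).trans hb
  have hbc : IsCoprime b (p : ℤ) := by
    obtain ⟨k, hk⟩ := hb1
    exact ⟨2, -k, by linear_combination hk⟩
  rw [sum_eq_GG]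
  refine ⟨?_, ?_, ?_, ?_, ?_⟩
  · intro he
    obtain ⟨k, rfl⟩ := he.two_dvd
    rw [GG_even p hp _ (ha.mul_left hbc), sqrt_pow_two_mul]
    push_cast; rfl
  · intro ho h8
    obtain ⟨t, ht⟩ : ∃ t, p = 2 * (4 * t) + 1 := ⟨p / 8, by omega⟩
    rw [main_odd p _ ht n ho a b ha hb1, negI_four, mul_one]
  · intro ho h8
    obtain ⟨t, ht⟩ : ∃ t, p = 2 * (4 * t + 1) + 1 := ⟨p / 8, by omega⟩
    rw [main_odd p _ ht n ho a b ha hb1, pow_add, negI_four]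
    ring
  · intro ho h8
    obtain ⟨t, ht⟩ : ∃ t, p = 2 * (4 * t + 2) + 1 := ⟨p / 8, by omega⟩
    rw [main_odd p _ ht n ho a b ha hb1, pow_add, negI_four, neg_sq, Complex.I_sq]
    ring
  · intro ho h8
    obtain ⟨t, ht⟩ : ∃ t, p = 2 * (4 * t + 3) + 1 := ⟨p / 8, by omega⟩
    rw [main_odd p _ ht n ho a b ha hb1, pow_add, negI_four, pow_succ, neg_sq, Complex.I_sq]
    ring
end

section
/- For every integer n ≥ 1 and every nonzero integer D, there exists a finite set S of symmetric n×n integer matrices such that every symmetric n×n integer matrix A with det A = D can be written as A = Pᵀ·B·P for some B ∈ S and some integer matrix P with det P = ±1. In other words, the set of isometry classes of symmetric bilinear forms on ℤⁿ with determinant D is finite. -/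
open Matrix

namespace FinForms

/-- `A` and `B` are integrally equivalent. -/
def Eqv {ι : Type} [Fintype ι] [DecidableEq ι] (A B : Matrix ι ι ℤ) : Prop :=
  ∃ P : Matrix ι ι ℤ, IsUnit P.det ∧ B = Pᵀ * A * P

section basics
variable {ι κ : Type} [Fintype ι] [DecidableEq ι] [Fintype κ] [DecidableEq κ]

lemma Eqv.rfl' (A : Matrix ι ι ℤ) : Eqv A A := ⟨1, by simp, by simp⟩

lemma Eqv.trans' {A B C : Matrix ι ι ℤ} (h : Eqv A B) (h' : Eqv B C) : Eqv A C := by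
  obtain ⟨P, hP, rfl⟩ := h
  obtain ⟨Q, hQ, rfl⟩ := h'
  exact ⟨P * Q, by rw [det_mul]; exact hP.mul hQ, by simp [Matrix.mul_assoc]⟩

lemma Eqv.det_eq {A B : Matrix ι ι ℤ} (h : Eqv A B) : B.det = A.det := by
  obtain ⟨P, hP, rfl⟩ := h
  rw [det_mul, det_mul, det_transpose]
  rcases Int.isUnit_iff.1 hP with h | h <;> simp [h]

lemma Eqv.symm_of {A B : Matrix ι ι ℤ} (h : Eqv A B) (hA : A.IsSymm) : B.IsSymm := by
  obtain ⟨P, hP, rfl⟩ := h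
  unfold Matrix.IsSymm at *
  simp [Matrix.mul_assoc, hA]

lemma Eqv.submatrix {A B : Matrix ι ι ℤ} (h : Eqv A B) (e : κ ≃ ι) :
    Eqv (A.submatrix e e) (B.submatrix e e) := by
  obtain ⟨P, hP, rfl⟩ := h
  refine ⟨P.submatrix e e, by simpa using hP, ?_⟩
  simp [Matrix.submatrix_mul_equiv]

lemma Eqv.perm (A : Matrix ι ι ℤ) (e : Equiv.Perm ι) : Eqv A (A.submatrix e e) := by
  refine ⟨(1 : Matrix ι ι ℤ).submatrix id e, ?_, ?_⟩
  · rw [det_permute']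
    simp
  · ext i j
    simp [Matrix.mul_apply, Matrix.one_apply]

/-- Bounded representatives. -/
def Bd (ι : Type) [Fintype ι] [DecidableEq ι] : Prop :=
  ∀ K : ℤ, ∃ M : ℤ, ∀ A : Matrix ι ι ℤ, A.IsSymm → A.det ≠ 0 → |A.det| ≤ K →
    ∃ B, Eqv A B ∧ ∀ i j, |B i j| ≤ M

/-- Hermite bound. -/
def He (ι : Type) [Fintype ι] [DecidableEq ι] : Prop :=
  ∃ C : ℤ, 0 ≤ C ∧ ∀ A : Matrix ι ι ℤ, A.IsSymm → A.det ≠ 0 →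
    ∃ B, ∃ i, Eqv A B ∧ |B i i| ^ (Fintype.card ι) ≤ C * |A.det|

lemma Bd.transport (h : Bd ι) (e : κ ≃ ι) : Bd κ := by
  intro K
  obtain ⟨M, hM⟩ := h K
  refine ⟨M, fun A hA h0 hK => ?_⟩
  obtain ⟨B, hB, hb⟩ := hM (A.submatrix e.symm e.symm) (hA.submatrix _) (by simpa using h0)
    (by simpa using hK)
  refine ⟨B.submatrix e e, ?_, fun i j => hb _ _⟩
  simpa using hB.submatrix e

lemma He.transport (h : He ι) (e : κ ≃ ι) : He κ := by
  obtain ⟨M, hM0, hM⟩ := h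
  refine ⟨M, hM0, fun A hA h0 => ?_⟩
  obtain ⟨B, i, hB, hb⟩ := hM (A.submatrix e.symm e.symm) (hA.submatrix _) (by simpa using h0)
  refine ⟨B.submatrix e e, e.symm i, ?_, ?_⟩
  · simpa using hB.submatrix e
  · rw [Fintype.card_congr e]
    simpa using hb

lemma exists_red (a b : ℤ) (ha : a ≠ 0) : ∃ k : ℤ, 2 * |a * k + b| ≤ |a| := by
  have h1 := Int.emod_add_mul_ediv b a
  have h2 := Int.emod_nonneg b ha
  have h3 := Int.emod_lt_abs b ha
  by_cases h : 2 * (b % a) ≤ |a|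
  · refine ⟨-(b / a), ?_⟩
    have : a * -(b / a) + b = b % a := by linarith
    rw [this, abs_of_nonneg h2]; exact h
  · refine ⟨-(b / a) - a.sign, ?_⟩
    have h4 : a * a.sign = |a| := by rw [mul_comm]; exact Int.sign_mul_self_eq_abs a
    have : a * (-(b / a) - a.sign) + b = b % a - |a| := by rw [← h4]; linarith
    rw [this, abs_of_nonpos (by linarith)]; linarith

/-- The bordered matrix. -/
abbrev bd (a : ℤ) (b : Matrix Unit ι ℤ) (C : Matrix ι ι ℤ) : Matrix (Unit ⊕ ι) (Unit ⊕ ι) ℤ :=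
  fromBlocks (a • (1 : Matrix Unit Unit ℤ)) b bᵀ C

lemma exists_bd (A : Matrix (Unit ⊕ ι) (Unit ⊕ ι) ℤ) (hA : A.IsSymm) :
    ∃ b C, C.IsSymm ∧ A = bd (A (Sum.inl ()) (Sum.inl ())) b C := by
  refine ⟨A.toBlocks₁₂, A.toBlocks₂₂, ?_, ?_⟩
  · ext i j; exact hA.apply _ _
  · ext (i | i) (j | j)
    · simp
    · rfl
    · exact hA.apply _ _
    · rfl

lemma bd_transform (a : ℤ) (b : Matrix Unit ι ℤ) (C : Matrix ι ι ℤ) (k : Matrix Unit ι ℤ)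
    (Q : Matrix ι ι ℤ) (hQ : IsUnit Q.det) :
    Eqv (bd a b C) (bd a (a • k + b * Q) (a • (kᵀ * k) + kᵀ * (b * Q) + (b * Q)ᵀ * k + Qᵀ * C * Q)) := by
  refine ⟨fromBlocks 1 k 0 Q, by simpa [-zsmul_eq_mul, -zsmul_one, -Int.smul_one_eq_cast] using hQ, ?_⟩
  simp only [bd, fromBlocks_transpose, fromBlocks_multiply]
  congr 1
  · simp [-zsmul_eq_mul, -zsmul_one, -Int.smul_one_eq_cast]
  · simp [-zsmul_eq_mul, -zsmul_one, -Int.smul_one_eq_cast]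
  · simp [-zsmul_eq_mul, -zsmul_one, -Int.smul_one_eq_cast]
  · simp [-zsmul_eq_mul, -zsmul_one, -Int.smul_one_eq_cast, Matrix.mul_add, Matrix.add_mul, Matrix.mul_assoc]
    abel

lemma bd_det (a : ℤ) (b : Matrix Unit ι ℤ) (C : Matrix ι ι ℤ) :
    (bd a b C).det * a ^ Fintype.card ι = a * (a • C - bᵀ * b).det := by
  have : bd a b C * fromBlocks 1 (-b) 0 (a • 1) =
      fromBlocks (a • (1 : Matrix Unit Unit ℤ)) 0 bᵀ (a • C - bᵀ * b) := by
    simp only [bd, fromBlocks_multiply]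
    congr 1 <;> simp [-zsmul_eq_mul, -zsmul_one, -Int.smul_one_eq_cast]
    abel
  have h := congrArg Matrix.det this
  rw [det_mul, det_fromBlocks_zero₂₁, det_fromBlocks_zero₁₂] at h
  simpa [-zsmul_eq_mul, -zsmul_one, -Int.smul_one_eq_cast] using h

lemma bd_reduce (a : ℤ) (ha : a ≠ 0) (b : Matrix Unit ι ℤ) (C Y : Matrix ι ι ℤ)
    (h : Eqv (a • C - bᵀ * b) Y) :
    ∃ b' C', Eqv (bd a b C) (bd a b' C') ∧ a • C' - b'ᵀ * b' = Y ∧ ∀ j, 2 * |b' () j| ≤ |a| := by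
  obtain ⟨Q, hQ, rfl⟩ := h
  choose k hk using fun j => exists_red a ((b * Q) () j) ha
  refine ⟨_, _, bd_transform a b C (Matrix.of fun _ j => k j) Q hQ, ?_, fun j => ?_⟩
  · generalize (Matrix.of fun _ j => k j : Matrix Unit ι ℤ) = k'
    simp [-zsmul_eq_mul, -zsmul_one, -Int.smul_one_eq_cast, Matrix.mul_add, Matrix.add_mul, Matrix.mul_assoc, Matrix.mul_sub, Matrix.sub_mul]
    abel
  · simpa [-zsmul_eq_mul, -zsmul_one, -Int.smul_one_eq_cast] using hk j

lemma he_unit : He (Unit ⊕ Fin 0) := by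
  refine ⟨1, by norm_num, fun A _ _ => ⟨A, Sum.inl (), Eqv.rfl' _, ?_⟩⟩
  have : A.det = A (Sum.inl ()) (Sum.inl ()) := by
    have : Unique (Unit ⊕ Fin 0) := (Equiv.sumEmpty Unit (Fin 0)).unique
    rw [Matrix.det_unique, Subsingleton.elim default (Sum.inl ())]
  simp [-zsmul_eq_mul, -zsmul_one, -Int.smul_one_eq_cast, this]

/-- minimal choice of corner -/
lemma exists_min {α : Type} (p : α → Prop) (f : α → ℤ) (h : ∃ x, p x) :
    ∃ x, p x ∧ ∀ y, p y → |f x| ≤ |f y| := by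
  obtain ⟨x, hx, hm⟩ := WellFounded.has_min (measure fun x => (f x).natAbs).wf {x | p x} h
  refine ⟨x, hx, fun y hy => ?_⟩
  have := hm y hy
  have h2 : ¬ (f y).natAbs < (f x).natAbs := this
  rw [Int.abs_eq_natAbs, Int.abs_eq_natAbs]
  omega

lemma he_step (h : He ι) : He (Unit ⊕ ι) := by
  obtain ⟨C, hC, H⟩ := h
  refine ⟨2 ^ Fintype.card ι * C, by positivity, fun A hA h0 => ?_⟩
  obtain ⟨A', hA', hmin⟩ := exists_min (Eqv A)
    (fun B => B (Sum.inl ()) (Sum.inl ())) ⟨A, Eqv.rfl' A⟩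
  refine ⟨A', Sum.inl (), hA', ?_⟩
  obtain ⟨b, E, hE, hAE⟩ := exists_bd A' (hA'.symm_of hA)
  set a := A' (Sum.inl ()) (Sum.inl ()) with ha
  by_cases ha0 : a = 0
  · rw [ha0]; simp [-zsmul_eq_mul, -zsmul_one, -Int.smul_one_eq_cast]; positivity
  have hdet := bd_det a b E
  rw [← hAE, hA'.det_eq] at hdet
  have hs : (a • E - bᵀ * b).IsSymm := by
    unfold Matrix.IsSymm at *
    simp [-zsmul_eq_mul, -zsmul_one, -Int.smul_one_eq_cast, hE]
  have hd0 : (a • E - bᵀ * b).det ≠ 0 := by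
    intro h
    rw [h, mul_zero] at hdet
    exact (mul_ne_zero h0 (pow_ne_zero _ ha0)) hdet
  obtain ⟨Y, i, hY, hYb⟩ := H _ hs hd0
  obtain ⟨b', C', hbC, hbY, hb'⟩ := bd_reduce a ha0 b E Y hY
  rw [← hAE] at hbC
  have hm := hmin _ ((hA'.trans' hbC).trans' (Eqv.perm _ (Equiv.swap (Sum.inl ()) (Sum.inr i))))
  simp [-zsmul_eq_mul, -zsmul_one, -Int.smul_one_eq_cast] at hm
  have hYi : Y i i = a * C' i i - b' () i * b' () i := by
    rw [← hbY]; simp [-zsmul_eq_mul, -zsmul_one, -Int.smul_one_eq_cast, Matrix.mul_apply]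
  have hb'i := hb' i
  have e1 : |a| ^ 2 ≤ 2 * |Y i i| := by
    have : a * C' i i = Y i i + b' () i * b' () i := by rw [hYi]; ring
    have h2 := abs_add_le (Y i i) (b' () i * b' () i)
    rw [← this, abs_mul, abs_mul] at h2
    nlinarith [abs_nonneg a, abs_nonneg (b' () i)]
  have habs : |A.det| * |a| ^ Fintype.card ι = |a| * |(a • E - bᵀ * b).det| := by
    rw [← abs_pow, ← abs_mul, hdet, abs_mul]
  have hapos : 0 < |a| := abs_pos.2 ha0
  have e2 : (|a| ^ 2) ^ Fintype.card ι ≤ (2 * |Y i i|) ^ Fintype.card ι := by gcongr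
  rw [mul_pow] at e2
  have e3 : (|a| ^ 2) ^ Fintype.card ι ≤ 2 ^ Fintype.card ι * (C * |(a • E - bᵀ * b).det|) :=
    e2.trans (by gcongr)
  have e4 := mul_le_mul_of_nonneg_left e3 hapos.le
  have e5 : |a| ^ Fintype.card ι * |a| ^ (Fintype.card ι + 1) ≤
      |a| ^ Fintype.card ι * (2 ^ Fintype.card ι * C * |A.det|) := by
    calc _ = |a| * (|a| ^ 2) ^ Fintype.card ι := by ring
      _ ≤ _ := e4
      _ = 2 ^ Fintype.card ι * C * (|a| * |(a • E - bᵀ * b).det|) := by ring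
      _ = _ := by rw [← habs]; ring
  have e6 := le_of_mul_le_mul_left e5 (by positivity)
  simpa [add_comm] using e6

lemma row_reduce (b : Matrix Unit (Unit ⊕ ι) ℤ) : ∃ Q : Matrix (Unit ⊕ ι) (Unit ⊕ ι) ℤ,
    IsUnit Q.det ∧ ∀ j, (b * Q) () (Sum.inr j) = 0 := by
  by_cases hb : ∃ Q : Matrix (Unit ⊕ ι) (Unit ⊕ ι) ℤ, IsUnit Q.det ∧ (b * Q) () (Sum.inl ()) ≠ 0
  · obtain ⟨Q, ⟨hQ, hQ0⟩, hmin⟩ := exists_min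
      (fun Q : Matrix (Unit ⊕ ι) (Unit ⊕ ι) ℤ => IsUnit Q.det ∧ (b * Q) () (Sum.inl ()) ≠ 0)
      (fun Q => (b * Q) () (Sum.inl ())) hb
    choose k hk using fun j => exists_red ((b * Q) () (Sum.inl ())) ((b * Q) () (Sum.inr j)) hQ0
    set R : Matrix (Unit ⊕ ι) (Unit ⊕ ι) ℤ := fromBlocks 1 (Matrix.of fun _ j => k j) 0 1 with hR
    have hRd : R.det = 1 := by simp [-zsmul_eq_mul, -zsmul_one, -Int.smul_one_eq_cast, hR]
    have hval : ∀ j, (b * (Q * R)) () (Sum.inr j) =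
        (b * Q) () (Sum.inl ()) * k j + (b * Q) () (Sum.inr j) := by
      intro j
      rw [← Matrix.mul_assoc, Matrix.mul_apply]
      simp [-zsmul_eq_mul, -zsmul_one, -Int.smul_one_eq_cast, hR, Matrix.one_apply]
    refine ⟨Q * R, by rw [det_mul, hRd, mul_one]; exact hQ, fun j => ?_⟩
    by_contra hne
    have hsw : ∀ T : Matrix (Unit ⊕ ι) (Unit ⊕ ι) ℤ, 
        (b * T.submatrix id (Equiv.swap (Sum.inl ()) (Sum.inr j))) () (Sum.inl ()) =
          (b * T) () (Sum.inr j) := by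
      intro T
      simp [-zsmul_eq_mul, -zsmul_one, -Int.smul_one_eq_cast, Matrix.mul_apply]
    have := hmin ((Q * R).submatrix id (Equiv.swap (Sum.inl ()) (Sum.inr j))) ⟨by
      rw [det_permute', det_mul, hRd]; simpa [-zsmul_eq_mul, -zsmul_one, -Int.smul_one_eq_cast] using hQ, by rw [hsw]; exact hne⟩
    simp only [hsw] at this
    have h1 := hk j
    rw [← hval] at h1
    have := abs_pos.2 hQ0
    linarith
  · push Not at hb
    refine ⟨1, by simp, fun j => ?_⟩
    have := hb ((1 : Matrix (Unit ⊕ ι) (Unit ⊕ ι) ℤ).submatrix id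
      (Equiv.swap (Sum.inl ()) (Sum.inr j))) (by rw [det_permute']; simp [-zsmul_eq_mul, -zsmul_one, -Int.smul_one_eq_cast])
    simpa [Matrix.mul_apply, Matrix.one_apply] using this

lemma hyp_det (d c : ℤ) (v : Matrix Unit ι ℤ) (C : Matrix ι ι ℤ)
    (b : Matrix Unit (Unit ⊕ ι) ℤ) (hb0 : b () (Sum.inl ()) = d) (hb : ∀ j, b () (Sum.inr j) = 0) :
    |(bd 0 b (bd c v C)).det| = d ^ 2 * |C.det| := by
  have h : (bd 0 b (bd c v C)).submatrix (Equiv.swap (Sum.inl ()) (Sum.inr (Sum.inl ()))) id =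
      fromBlocks (d • (1 : Matrix Unit Unit ℤ)) (Matrix.of fun _ j => bd c v C (Sum.inl ()) j) 0
        (fromBlocks (d • (1 : Matrix Unit Unit ℤ)) 0 vᵀ C) := by
    ext (i | i | i) (j | j | j) <;>
      simp [-zsmul_eq_mul, -zsmul_one, -Int.smul_one_eq_cast, hb0, hb, Equiv.swap_apply_def]
  have h2 := congrArg (fun M => |Matrix.det M|) h
  simp only [det_fromBlocks_zero₂₁, det_fromBlocks_zero₁₂, det_permute] at h2
  simp [-zsmul_eq_mul, -zsmul_one, -Int.smul_one_eq_cast, abs_mul] at h2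
  rw [h2, ← mul_assoc, abs_mul_abs_self, sq]

lemma bd_step (h1 : Bd ι) (h2 : Bd (Unit ⊕ ι)) (hH : He (Unit ⊕ (Unit ⊕ ι))) :
    Bd (Unit ⊕ (Unit ⊕ ι)) := by
  intro K
  obtain ⟨C, hC, H⟩ := hH
  obtain ⟨M1, hM1⟩ := h1 K
  set N := Fintype.card (Unit ⊕ ι) with hN
  obtain ⟨M2, hM2⟩ := h2 (K * (C * K) ^ N)
  refine ⟨max (M2 + (C * K) ^ 2 + C * K) (max M1 K), fun A hA h0 hK => ?_⟩
  have hK0 : 0 < K := (abs_pos.2 h0).trans_le hK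
  obtain ⟨B₀, i, hB₀, hBi⟩ := H A hA h0
  obtain ⟨B, hB, hBa⟩ : ∃ B, Eqv A B ∧ |B (Sum.inl ()) (Sum.inl ())| ^ (N + 1) ≤ C * |A.det| := by
    refine ⟨_, hB₀.trans' (Eqv.perm _ (Equiv.swap (Sum.inl ()) i)), ?_⟩
    simpa [hN, add_comm] using hBi
  obtain ⟨b, E, hE, hBE⟩ := exists_bd B (hB.symm_of hA)
  set a := B (Sum.inl ()) (Sum.inl ()) with ha
  by_cases ha0 : a = 0
  · -- isotropic case
    rw [ha0] at hBE
    obtain ⟨Q, hQ, hQb⟩ := row_reduce b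
    have s1 := bd_transform 0 b E 0 Q hQ
    simp only [zero_smul, zero_add, transpose_zero, Matrix.zero_mul, Matrix.mul_zero] at s1
    rw [← hBE] at s1
    have s2 := hB.trans' s1
    have hE' : (Qᵀ * E * Q).IsSymm := Eqv.symm_of ⟨Q, hQ, rfl⟩ hE
    generalize b * Q = b' at *
    generalize Qᵀ * E * Q = E' at *
    obtain ⟨v, F, hF, hEF⟩ := exists_bd E' hE'
    generalize E' (Sum.inl ()) (Sum.inl ()) = c at *
    subst hEF
    have hd := hyp_det (b' () (Sum.inl ())) c v F b' rfl hQb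
    rw [s2.det_eq] at hd
    set d := b' () (Sum.inl ()) with hdd
    have hAd := abs_pos.2 h0
    have hd0 : d ≠ 0 := by rintro h; rw [h] at hd; simp [-zsmul_eq_mul, -zsmul_one, -Int.smul_one_eq_cast] at hd; exact h0 hd
    have hF0 : F.det ≠ 0 := by rintro h; rw [h] at hd; simp [-zsmul_eq_mul, -zsmul_one, -Int.smul_one_eq_cast] at hd; exact h0 hd
    have hFp := abs_pos.2 hF0
    have hdp := abs_pos.2 hd0
    have hd2 : d ^ 2 = |d| ^ 2 := (sq_abs d).symm
    have hd1 : 1 ≤ |d| ^ 2 := one_le_pow₀ hdp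
    have hFK : |F.det| ≤ K := by
      rw [hd, hd2] at hK
      nlinarith
    have hdK : |d| ≤ K := by
      rw [hd, hd2] at hK
      nlinarith
    obtain ⟨G, ⟨R, hR, rfl⟩, hG⟩ := hM1 F hF hF0 hFK
    -- conjugate the tail block
    have t1 := bd_transform 0 b' (bd c v F) 0 (fromBlocks 1 0 0 R) (by simpa [-zsmul_eq_mul, -zsmul_one, -Int.smul_one_eq_cast] using hR)
    simp only [zero_smul, zero_add, transpose_zero, Matrix.zero_mul, Matrix.mul_zero] at t1
    have hbR : b' * (fromBlocks 1 0 0 R : Matrix (Unit ⊕ ι) (Unit ⊕ ι) ℤ) = b' := by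
      ext i (j | j) <;> simp [-zsmul_eq_mul, -zsmul_one, -Int.smul_one_eq_cast, Matrix.mul_apply, hQb, Matrix.one_apply]
    have hFR : (fromBlocks 1 0 0 R : Matrix (Unit ⊕ ι) (Unit ⊕ ι) ℤ)ᵀ * bd c v F *
        (fromBlocks 1 0 0 R : Matrix (Unit ⊕ ι) (Unit ⊕ ι) ℤ) = bd c (v * R) (Rᵀ * F * R) := by
      simp [-zsmul_eq_mul, -zsmul_one, -Int.smul_one_eq_cast, bd, fromBlocks_transpose, fromBlocks_multiply]
    rw [hbR, hFR] at t1
    have s3 := s2.trans' t1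
    generalize v * R = w at *
    generalize Rᵀ * F * R = G at *
    obtain ⟨k0, hk0⟩ := exists_red (2 * d) c (by simpa [-zsmul_eq_mul, -zsmul_one, -Int.smul_one_eq_cast] using hd0)
    choose k hk using fun j => exists_red d (w () j) hd0
    have t2 := bd_transform 0 b' (bd c w G)
      (Matrix.of fun _ j => Sum.elim (fun _ => k0) k j) 1 (by simp [-zsmul_eq_mul, -zsmul_one, -Int.smul_one_eq_cast])
    refine ⟨_, s3.trans' t2, ?_⟩
    have hKm : K ≤ max (M2 + (C * K) ^ 2 + C * K) (max M1 K) := by simp [-zsmul_eq_mul, -zsmul_one, -Int.smul_one_eq_cast]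
    have hMm : M1 ≤ max (M2 + (C * K) ^ 2 + C * K) (max M1 K) := by simp [-zsmul_eq_mul, -zsmul_one, -Int.smul_one_eq_cast]
    generalize max (M2 + (C * K) ^ 2 + C * K) (max M1 K) = M at *
    have hM0 : 0 ≤ M := by linarith
    have hdM : |d| ≤ M := by linarith
    rw [abs_mul] at hk0
    norm_num at hk0
    have q1 : |k0 * d + d * k0 + c| ≤ M := by
      rw [show k0 * d + d * k0 + c = 2 * d * k0 + c by ring]; linarith
    have q2 : ∀ j, |d * k j + w () j| ≤ M := fun j => by
      have := hk j
      have := abs_nonneg (d * k j + w () j)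
      linarith
    have q3 : ∀ j, |k j * d + w () j| ≤ M := fun j => by rw [mul_comm]; exact q2 j
    rintro (i | i | i) (j | j | j) <;>
      simp [-zsmul_eq_mul, -zsmul_one, -Int.smul_one_eq_cast, Matrix.mul_apply, hQb, ← hdd, hM0, hdM, q1, q2, q3, (hG _ _).trans hMm]
  · have hdet := bd_det a b E
    rw [← hBE, hB.det_eq, ← hN] at hdet
    have hs : (a • E - bᵀ * b).IsSymm := by
      unfold Matrix.IsSymm at *
      simp [-zsmul_eq_mul, -zsmul_one, -Int.smul_one_eq_cast, hE]
    have hd0 : (a • E - bᵀ * b).det ≠ 0 := by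
      intro h
      rw [h, mul_zero] at hdet
      exact (mul_ne_zero h0 (pow_ne_zero _ ha0)) hdet
    have hap : 0 < |a| := abs_pos.2 ha0
    have haK : |a| ≤ C * K := by
      calc |a| ≤ |a| ^ (N + 1) := le_self_pow₀ (by linarith) (by omega)
        _ ≤ _ := hBa
        _ ≤ _ := by gcongr
    have habs : |A.det| * |a| ^ N = |a| * |(a • E - bᵀ * b).det| := by
      rw [← abs_pow, ← abs_mul, hdet, abs_mul]
    have hdK : |(a • E - bᵀ * b).det| ≤ K * (C * K) ^ N := by
      calc |(a • E - bᵀ * b).det| ≤ |a| * |(a • E - bᵀ * b).det| := 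
            le_mul_of_one_le_left (abs_nonneg _) (by linarith)
        _ = |A.det| * |a| ^ N := habs.symm
        _ ≤ _ := by gcongr
    obtain ⟨Y, hY, hYb⟩ := hM2 _ hs hd0 hdK
    obtain ⟨b', C', hbC, hbY, hb'⟩ := bd_reduce a ha0 b E Y hY
    rw [← hBE] at hbC
    refine ⟨_, hB.trans' hbC, ?_⟩
    have hm : M2 + (C * K) ^ 2 + C * K ≤ max (M2 + (C * K) ^ 2 + C * K) (max M1 K) := by simp [-zsmul_eq_mul, -zsmul_one, -Int.smul_one_eq_cast]
    generalize max (M2 + (C * K) ^ 2 + C * K) (max M1 K) = M at *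
    have hM20 : 0 ≤ M2 := (abs_nonneg _).trans (hYb (Sum.inl ()) (Sum.inl ()))
    have q0 : |a| ≤ M := by nlinarith
    have qb : ∀ j, |b' () j| ≤ |a| := fun j => by
      have := hb' j
      have := abs_nonneg (b' () j)
      linarith
    have qC : ∀ i j, |C' i j| ≤ M := by
      intro i j
      have hYi : Y i j = a * C' i j - b' () i * b' () j := by
        rw [← hbY]; simp [-zsmul_eq_mul, -zsmul_one, -Int.smul_one_eq_cast, Matrix.mul_apply]
      have h3 : a * C' i j = Y i j + b' () i * b' () j := by rw [hYi]; ring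
      have h4 := abs_add_le (Y i j) (b' () i * b' () j)
      rw [← h3, abs_mul, abs_mul] at h4
      have h5 : |C' i j| ≤ |a| * |C' i j| := 
        le_mul_of_one_le_left (abs_nonneg _) (by linarith)
      have h6 : |b' () i| * |b' () j| ≤ (C * K) * (C * K) := by
        gcongr
        · exact (qb i).trans haK
        · exact (qb j).trans haK
      have h7 := hYb i j
      nlinarith
    rintro (i | i) (j | j)
    · simpa [-zsmul_eq_mul, -zsmul_one, -Int.smul_one_eq_cast] using q0
    · exact (qb j).trans q0
    · exact (qb i).trans q0
    · exact qC i j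

end basics

lemma bd_zero : Bd (Fin 0) := fun _ => ⟨0, fun A _ _ _ => ⟨A, Eqv.rfl' A, fun i => i.elim0⟩⟩

lemma bd_one : Bd (Unit ⊕ Fin 0) := by
  intro K
  refine ⟨K, fun A _ _ hK => ⟨A, Eqv.rfl' A, fun i j => ?_⟩⟩
  have : Unique (Unit ⊕ Fin 0) := (Equiv.sumEmpty Unit (Fin 0)).unique
  rw [Matrix.det_unique] at hK
  rwa [Subsingleton.elim i default, Subsingleton.elim j default]

/-- Splitting off a point. -/
noncomputable def eFin (n : ℕ) : Fin (n + 1) ≃ Unit ⊕ Fin n :=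
  Fintype.equivOfCardEq (by simp [add_comm])

lemma he_all (n : ℕ) : He (Unit ⊕ Fin n) := by
  induction n with
  | zero => exact he_unit
  | succ n ih => exact he_step (ih.transport (eFin n))

lemma bd_all (n : ℕ) : Bd (Fin n) ∧ Bd (Unit ⊕ Fin n) := by
  induction n with
  | zero => exact ⟨bd_zero, bd_one⟩
  | succ n ih =>
    have h := bd_step ih.1 ih.2 (he_step (he_all n))
    exact ⟨ih.2.transport (eFin n), h.transport (Equiv.sumCongr (Equiv.refl _) (eFin n))⟩

end FinForms


/-- For every `n ≥ 1` and nonzero `D`, there are only finitely many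
isometry classes of symmetric bilinear forms on `ℤⁿ` with determinant `D`: there is a
finite set `S` of symmetric integer matrices such that every symmetric integer matrix `A`
with `det A = D` equals `Pᵀ·B·P` for some `B ∈ S` and some `P ∈ GL_n(ℤ)`. -/
theorem stmt_8 (n : ℕ) (hn : 1 ≤ n) (D : ℤ) (hD : D ≠ 0) :
    ∃ S : Finset (Matrix (Fin n) (Fin n) ℤ),
      (∀ B ∈ S, B.IsSymm) ∧
      ∀ A : Matrix (Fin n) (Fin n) ℤ, A.IsSymm → A.det = D →
        ∃ B ∈ S, ∃ P : Matrix (Fin n) (Fin n) ℤ,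
          (P.det = 1 ∨ P.det = -1) ∧ A = P.transpose * B * P := by
  classical
  obtain ⟨M, hM⟩ := (FinForms.bd_all n).1 |D|
  have hfin : {B : Matrix (Fin n) (Fin n) ℤ | B.IsSymm ∧ ∀ i j, |B i j| ≤ M}.Finite := by
    refine Set.Finite.subset (Set.Finite.pi' (fun _ : Fin n => Set.Finite.pi'
      (fun _ : Fin n => Set.finite_Icc (-M) M))) ?_
    intro B hB i j
    exact abs_le.1 (hB.2 i j)
  refine ⟨hfin.toFinset, fun B hB => ((hfin.mem_toFinset).1 hB).1, fun A hA hdet => ?_⟩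
  obtain ⟨B, hAB, hB⟩ := hM A hA (by rw [hdet]; exact hD) (by rw [hdet])
  refine ⟨B, (hfin.mem_toFinset).2 ⟨hAB.symm_of hA, hB⟩, ?_⟩
  obtain ⟨P, hP, rfl⟩ := hAB
  have h1 : P * P⁻¹ = 1 := Matrix.mul_nonsing_inv P hP
  have h2 : P⁻¹.transpose * P.transpose = 1 := by
    rw [← Matrix.transpose_mul, h1, Matrix.transpose_one]
  refine ⟨P⁻¹, Int.isUnit_iff.1 (by rw [Matrix.isUnit_nonsing_inv_det_iff]; exact hP), ?_⟩
  calc A = (P⁻¹.transpose * P.transpose) * A * (P * P⁻¹) := by rw [h1, h2]; simp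
    _ = _ := by simp only [Matrix.mul_assoc]
end
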